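/- Empirical excess-risk bound for the plug-in ERM student (intermediate step of the Appendix refined Vanilla KD theorem). Let z_1,…,z_n be data points with z_i=(x_i,y_i), let F be a convex class of functions 𝒳→ℝ^k, and suppose ℓ(z;φ,π) is σ-strongly convex and continuously differentiable in φ and twice continuously differentiable in (φ,π). Let p̂ be any teacher function and f̂ = argmin_{f∈F} (1/n)Σ_i ℓ(z_i; f(x_i), p̂(x_i)). Define γ̃_{f,p}(z) = E_{U,V indep ~ Unif[0,1]}[ ∇_{φπ} ℓ(z; V·f(x)+(1−V)·f0(x), U·p(x)+(1−U)·p0(x)) ]. Then for every f0∈F: (1/n)Σ_{i=1}^n [ ℓ(z_i; f̂(x_i), p0(x_i)) − ℓ(z_i; f0(x_i), p0(x_i)) ] ≤ (1/(2σ)) · (1/n)Σ_{i=1}^n ‖ γ̃_{f̂,p̂}(z_i)ᵀ ( p0(x_i) − p̂(x_i) ) ‖₂². -/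

import Mathlib

open MeasureTheory ProbabilityTheory Real Set
open scoped RealInnerProductSpace

noncomputable section

abbrev Vec (k : ℕ) := EuclideanSpace ℝ (Fin k)

/-- turn a plain function into a Euclidean vector -/
def vecOf {k : ℕ} (g : Fin k → ℝ) : Vec k := (WithLp.equiv 2 (Fin k → ℝ)).symm g

/-- matrix-vector product as Euclidean vectors -/
def mulVecE {m n : ℕ} (A : Matrix (Fin m) (Fin n) ℝ) (v : EuclideanSpace ℝ (Fin n)) :
    EuclideanSpace ℝ (Fin m) :=
  (WithLp.equiv 2 (Fin m → ℝ)).symm (A.mulVec (WithLp.equiv 2 (Fin n → ℝ) v))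

/-- transposed matrix-vector product `Aᵀ v` -/
def tmulVec {m n : ℕ} (A : Matrix (Fin m) (Fin n) ℝ) (v : EuclideanSpace ℝ (Fin m)) :
    EuclideanSpace ℝ (Fin n) :=
  mulVecE A.transpose v

/-- `‖g‖_{2,q} = E[‖g(X)‖₂^q]^{1/q}` -/
def lpq {𝒳 : Type*} [MeasurableSpace 𝒳] {E : Type*} [NormedAddCommGroup E]
    (μ : Measure 𝒳) (q : ℝ) (g : 𝒳 → E) : ℝ :=
  (∫ x, ‖g x‖ ^ q ∂μ) ^ (1 / q)

/-- gradient of the loss in its second (prediction) argument -/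
def gradPhi {𝒳 : Type*} {k : ℕ} (ℓ : 𝒳 → Vec k → Vec k → Vec k → ℝ)
    (x : 𝒳) (y φ pv : Vec k) : Vec k :=
  gradient (fun φ' => ℓ x y φ' pv) φ

/-- cross-derivative matrix `[∇_{φπ} ℓ]_{i,j} = ∂²ℓ/∂φ_j∂π_i` -/
def crossDeriv {𝒳 : Type*} {k : ℕ} (ℓ : 𝒳 → Vec k → Vec k → Vec k → ℝ)
    (x : 𝒳) (y φ pv : Vec k) : Matrix (Fin k) (Fin k) ℝ :=
  fun i j => fderiv ℝ (fun pv' => gradPhi ℓ x y φ pv') pv (EuclideanSpace.single i 1) j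

/-- conditional expectation `q_{f,p}(x) = E[∇_{φπ} ℓ(Z;f(X),p(X)) | X = x]` -/
def qMat {𝒳 : Type*} [MeasurableSpace 𝒳] {k : ℕ} (κ : 𝒳 → Measure (Vec k))
    (ℓ : 𝒳 → Vec k → Vec k → Vec k → ℝ) (f p : 𝒳 → Vec k) (x : 𝒳) :
    Matrix (Fin k) (Fin k) ℝ :=
  fun i j => ∫ y, crossDeriv ℓ x y (f x) (p x) i j ∂(κ x)

/-- `γ_{f,p}(x) = E_{U~Unif[0,1]}[q_{f,Up+(1-U)p0}(x)]` -/
def gammaMat {𝒳 : Type*} [MeasurableSpace 𝒳] {k : ℕ} (κ : 𝒳 → Measure (Vec k))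
    (ℓ : 𝒳 → Vec k → Vec k → Vec k → ℝ) (p0 f p : 𝒳 → Vec k) (x : 𝒳) :
    Matrix (Fin k) (Fin k) ℝ :=
  fun i j =>
    ∫ u in (0:ℝ)..1, qMat κ ℓ f (fun x' => u • p x' + (1 - u) • p0 x') x i j

/-- sign associated to a boolean Rademacher variable -/
def signVal (b : Bool) : ℝ := if b then 1 else -1

/-- localized Rademacher complexity of a function class -/
def localRademacher {Z : Type*} [MeasurableSpace Z] (μZ : Measure Z) (n : ℕ)
    (G : Set (Z → ℝ)) (δ : ℝ) : ℝ :=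
  ∫ z : Fin n → Z,
    ∫ ε : Fin n → Bool,
      (⨆ g : {g : Z → ℝ // g ∈ G ∧ (∫ w, (g w) ^ 2 ∂μZ) ^ ((1:ℝ)/2) ≤ δ},
        (1 / (n : ℝ)) * ∑ i, signVal (ε i) * (g : Z → ℝ) (z i))
      ∂((PMF.uniformOfFintype (Fin n → Bool)).toMeasure)
    ∂(Measure.pi fun _ => μZ)

/-- critical radius: smallest positive solution of `R(δ;G) ≤ δ²/H` -/
def criticalRadius {Z : Type*} [MeasurableSpace Z] (μZ : Measure Z) (n : ℕ)
    (G : Set (Z → ℝ)) (H : ℝ) : ℝ :=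
  sInf {δ : ℝ | 0 < δ ∧ localRademacher μZ n G δ ≤ δ ^ 2 / H}

/-- the doubly-averaged cross derivative
`γ̃_{f,p}(z) = E_{U,V~Unif[0,1]}[∇_{φπ} ℓ(z; Vf(x)+(1−V)f0(x), Up(x)+(1−U)p0(x))]` -/
def gammaTilde {𝒳 : Type*} {k : ℕ} (ℓ : 𝒳 → Vec k → Vec k → Vec k → ℝ)
    (p0 f0 f p : 𝒳 → Vec k) (z : 𝒳 × Vec k) : Matrix (Fin k) (Fin k) ℝ :=
  fun i j =>
    ∫ v in (0:ℝ)..1, ∫ u in (0:ℝ)..1,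
      crossDeriv ℓ z.1 z.2 (v • f z.1 + (1 - v) • f0 z.1)
        (u • p z.1 + (1 - u) • p0 z.1) i j


lemma sc_aux {k : ℕ} (L : Vec k → ℝ) (g : Vec k → Vec k) (σ : ℝ)
    (h : ∀ φ φ', L φ + ⟪g φ, φ' - φ⟫ + σ / 2 * ‖φ' - φ‖ ^ 2 ≤ L φ')
    (a b : Vec k) (t : ℝ) (h0 : 0 ≤ t) (h1 : t ≤ 1) :
    L ((1 - t) • a + t • b) ≤ (1 - t) * L a + t * L b - σ / 2 * (t * (1 - t)) * ‖a - b‖ ^ 2 := by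
  have ha := h ((1 - t) • a + t • b) a
  have hb := h ((1 - t) • a + t • b) b
  have e1 : a - ((1 - t) • a + t • b) = t • (a - b) := by module
  have e2 : b - ((1 - t) • a + t • b) = (-(1 - t)) • (a - b) := by module
  rw [e1, inner_smul_right, norm_smul, mul_pow, Real.norm_eq_abs, sq_abs] at ha
  rw [e2, inner_smul_right, norm_smul, mul_pow, Real.norm_eq_abs, sq_abs] at hb
  have ha' := mul_le_mul_of_nonneg_left ha (sub_nonneg.2 h1)
  have hb' := mul_le_mul_of_nonneg_left hb h0
  nlinarith [ha', hb']

lemma lim_aux (A B : ℝ) (h : ∀ t : ℝ, 0 < t → t < 1 → A ≤ -((1 - t) * B)) : A ≤ -B := by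
  have hc : Filter.Tendsto (fun t : ℝ => -((1 - t) * B)) (nhdsWithin 0 (Set.Ioi 0))
      (nhds (-((1 - 0) * B))) := by
    apply Filter.Tendsto.mono_left _ nhdsWithin_le_nhds
    exact Continuous.tendsto (by fun_prop) _
  have := ge_of_tendsto hc (b := A) (by
    filter_upwards [Ioo_mem_nhdsGT (show (0:ℝ) < 1 by norm_num)] with t ht
    exact h t ht.1 ht.2)
  simpa using this

def Gfun {k : ℕ} (L : Vec k × Vec k → ℝ) (q : Vec k × Vec k) : Vec k :=
  (InnerProductSpace.toDual ℝ (Vec k)).symm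
    ((fderiv ℝ L q).comp (ContinuousLinearMap.inl ℝ (Vec k) (Vec k)))

lemma Gfun_contDiff {k : ℕ} (L : Vec k × Vec k → ℝ) (hL : ContDiff ℝ 2 L) :
    ContDiff ℝ 1 (Gfun L) := by
  have h1 : ContDiff ℝ 1 (fderiv ℝ L) := hL.fderiv_right (by norm_num)
  have h2 : ContDiff ℝ 1 (fun q => (fderiv ℝ L q).comp
      (ContinuousLinearMap.inl ℝ (Vec k) (Vec k))) := h1.clm_comp contDiff_const
  exact (InnerProductSpace.toDual ℝ (Vec k)).symm.toContinuousLinearEquiv.contDiff.comp h2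

lemma inner_Gfun {k : ℕ} (L : Vec k × Vec k → ℝ) (q : Vec k × Vec k) (D : Vec k) :
    ⟪Gfun L q, D⟫ = fderiv ℝ L q (D, 0) := by
  simp [Gfun]

lemma gradPhi_eq {𝒳 : Type*} {k : ℕ} (ℓ : 𝒳 → Vec k → Vec k → Vec k → ℝ) (x : 𝒳) (y : Vec k)
    (h : ContDiff ℝ 2 (fun q : Vec k × Vec k => ℓ x y q.1 q.2)) (φ pv : Vec k) :
    gradPhi ℓ x y φ pv = Gfun (fun q : Vec k × Vec k => ℓ x y q.1 q.2) (φ, pv) := by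
  unfold gradPhi gradient Gfun
  congr 1
  have hd := (h.differentiable (by norm_num) (φ, pv)).hasFDerivAt
  exact (HasFDerivAt.comp (g := fun q : Vec k × Vec k => ℓ x y q.1 q.2) (f := fun e => (e, pv)) φ hd
    (hasFDerivAt_prodMk_left φ pv)).fderiv

lemma crossDeriv_eq {𝒳 : Type*} {k : ℕ} (ℓ : 𝒳 → Vec k → Vec k → Vec k → ℝ) (x : 𝒳) (y : Vec k)
    (h : ContDiff ℝ 2 (fun q : Vec k × Vec k => ℓ x y q.1 q.2)) (φ pv : Vec k) (i j : Fin k) :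
    crossDeriv ℓ x y φ pv i j = (fderiv ℝ (Gfun (fun q : Vec k × Vec k => ℓ x y q.1 q.2)) (φ, pv)
      (0, EuclideanSpace.single i 1)) j := by
  unfold crossDeriv
  have e : (fun pv' => gradPhi ℓ x y φ pv') =
      fun pv' => Gfun (fun q : Vec k × Vec k => ℓ x y q.1 q.2) (φ, pv') := by
    funext pv'; exact gradPhi_eq ℓ x y h φ pv'
  rw [e]
  have hd := (((Gfun_contDiff _ h).differentiable (by norm_num)) (φ, pv)).hasFDerivAt
  have := (hd.comp pv (hasFDerivAt_prodMk_right φ pv)).fderiv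
  have e2 : fderiv ℝ (fun pv' => Gfun (fun q : Vec k × Vec k => ℓ x y q.1 q.2) (φ, pv')) pv =
    _ := this
  rw [e2]
  simp

lemma sum_aux {k : ℕ} (T : Vec k × Vec k →L[ℝ] Vec k) (w D : Vec k) :
    ∑ j, ∑ i, (D j * w i) * (T (0, EuclideanSpace.single i 1)) j = ⟪T (0, w), D⟫ := by
  have hw : (0, w) = ∑ i, w i • ((0, EuclideanSpace.single i 1) : Vec k × Vec k) := by
    ext1
    · simp [Prod.fst_sum]
    · rw [Prod.snd_sum]
      ext j
      simp [Pi.single_apply]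
  rw [hw, map_sum, PiLp.inner_apply]
  apply Finset.sum_congr rfl
  intro j _
  simp only [map_smul, WithLp.ofLp_sum, WithLp.ofLp_smul, Finset.sum_apply, Pi.smul_apply,
    smul_eq_mul, RCLike.inner_apply, conj_trivial, Finset.mul_sum, mul_assoc]

lemma double_int {k : ℕ} (L : Vec k × Vec k → ℝ) (hL : ContDiff ℝ 2 L) (f f0 p p0 : Vec k) :
    ∫ v in (0:ℝ)..1, ∫ u in (0:ℝ)..1,
      ⟪fderiv ℝ (Gfun L) (v • f + (1 - v) • f0, u • p + (1 - u) • p0) (0, p0 - p), f - f0⟫ =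
    (L (f, p0) - L (f0, p0)) - (L (f, p) - L (f0, p)) := by
  have hG := Gfun_contDiff L hL
  have hGc : Continuous (fderiv ℝ (Gfun L)) := hG.continuous_fderiv (by norm_num)
  have hGd := hG.differentiable (by norm_num)
  have hLc : Continuous (fderiv ℝ L) := hL.continuous_fderiv (by norm_num)
  have hLd := hL.differentiable (by norm_num)
  have inner1 : ∀ v : ℝ, ∫ u in (0:ℝ)..1,
      ⟪fderiv ℝ (Gfun L) (v • f + (1 - v) • f0, u • p + (1 - u) • p0) (0, p0 - p), f - f0⟫ =
      fderiv ℝ L (v • f + (1 - v) • f0, p0) (f - f0, 0)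
        - fderiv ℝ L (v • f + (1 - v) • f0, p) (f - f0, 0) := by
    intro v
    have hder : ∀ u ∈ Set.uIcc (0:ℝ) 1, HasDerivAt
        (fun u : ℝ => -⟪Gfun L (v • f + (1 - v) • f0, u • p + (1 - u) • p0), f - f0⟫)
        ⟪fderiv ℝ (Gfun L) (v • f + (1 - v) • f0, u • p + (1 - u) • p0) (0, p0 - p), f - f0⟫ u := by
      intro u _
      have hp : HasDerivAt (fun u : ℝ => u • p + (1 - u) • p0) (p - p0) u := by
        have := ((hasDerivAt_id u).smul_const p).add
          (((hasDerivAt_id u).const_sub 1).smul_const p0)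
        exact this.congr_deriv (by module)
      have hpp := (hasDerivAt_const u (v • f + (1 - v) • f0)).prodMk hp
      have h1 := (hGd _).hasFDerivAt.comp_hasDerivAt u hpp
      have h2 := (h1.inner ℝ (hasDerivAt_const u (f - f0))).neg
      refine h2.congr_deriv ?_
      have : ((0, p0 - p) : Vec k × Vec k) = -(0, p - p0) := by ext1 <;> simp
      rw [this, map_neg, inner_neg_left]
      simp
    rw [intervalIntegral.integral_eq_sub_of_hasDerivAt hder]
    · simp only [inner_Gfun]
      simp
      ring
    · apply Continuous.intervalIntegrable
      fun_prop
  simp_rw [inner1]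
  have hder : ∀ v ∈ Set.uIcc (0:ℝ) 1, HasDerivAt
      (fun v : ℝ => L (v • f + (1 - v) • f0, p0) - L (v • f + (1 - v) • f0, p))
      (fderiv ℝ L (v • f + (1 - v) • f0, p0) (f - f0, 0)
        - fderiv ℝ L (v • f + (1 - v) • f0, p) (f - f0, 0)) v := by
    intro v _
    have hp : HasDerivAt (fun u : ℝ => u • f + (1 - u) • f0) (f - f0) v := by
      have := ((hasDerivAt_id v).smul_const f).add
        (((hasDerivAt_id v).const_sub 1).smul_const f0)
      exact this.congr_deriv (by module)
    exact ((hLd _).hasFDerivAt.comp_hasDerivAt v (hp.prodMk (hasDerivAt_const v p0))).sub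
      ((hLd _).hasFDerivAt.comp_hasDerivAt v (hp.prodMk (hasDerivAt_const v p)))
  rw [intervalIntegral.integral_eq_sub_of_hasDerivAt hder]
  · simp
    ring
  · apply Continuous.intervalIntegrable
    fun_prop

lemma gamma_inner {𝒳 : Type*} {k : ℕ} (ℓ : 𝒳 → Vec k → Vec k → Vec k → ℝ)
    (p0 f0 f p : 𝒳 → Vec k) (z : 𝒳 × Vec k)
    (h : ContDiff ℝ 2 (fun q : Vec k × Vec k => ℓ z.1 z.2 q.1 q.2)) :
    ⟪tmulVec (gammaTilde ℓ p0 f0 f p z) (p0 z.1 - p z.1), f z.1 - f0 z.1⟫ =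
    (ℓ z.1 z.2 (f z.1) (p0 z.1) - ℓ z.1 z.2 (f0 z.1) (p0 z.1)) -
    (ℓ z.1 z.2 (f z.1) (p z.1) - ℓ z.1 z.2 (f0 z.1) (p z.1)) := by
  have hGc : Continuous (fderiv ℝ (Gfun (fun q : Vec k × Vec k => ℓ z.1 z.2 q.1 q.2))) :=
    (Gfun_contDiff _ h).continuous_fderiv (by norm_num)
  have := double_int _ h (f z.1) (f0 z.1) (p z.1) (p0 z.1)
  rw [← this]
  simp_rw [← sum_aux]
  set T := fderiv ℝ (Gfun (fun q : Vec k × Vec k => ℓ z.1 z.2 q.1 q.2)) with hT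
  have hC : ∀ i j : Fin k, Continuous (fun q : ℝ × ℝ =>
      (T (q.1 • f z.1 + (1 - q.1) • f0 z.1, q.2 • p z.1 + (1 - q.2) • p0 z.1)
        (0, EuclideanSpace.single i 1)) j) := by
    intro i j
    fun_prop
  have hC1 : ∀ (i j : Fin k) (v : ℝ), Continuous (fun u : ℝ =>
      (T (v • f z.1 + (1 - v) • f0 z.1, u • p z.1 + (1 - u) • p0 z.1)
        (0, EuclideanSpace.single i 1)) j) := by
    intro i j v
    fun_prop
  have hC2 : ∀ i j : Fin k, Continuous (fun v : ℝ => ∫ u in (0:ℝ)..1,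
      (T (v • f z.1 + (1 - v) • f0 z.1, u • p z.1 + (1 - u) • p0 z.1)
        (0, EuclideanSpace.single i 1)) j) := by
    intro i j
    exact intervalIntegral.continuous_parametric_intervalIntegral_of_continuous' (hC i j) 0 1
  have e1 : ∀ v : ℝ, (∫ u in (0:ℝ)..1, ∑ j, ∑ i,
      ((f z.1 - f0 z.1) j * (p0 z.1 - p z.1) i) *
      (T (v • f z.1 + (1 - v) • f0 z.1, u • p z.1 + (1 - u) • p0 z.1)
        (0, EuclideanSpace.single i 1)) j) = ∑ j, ∑ i,
      ((f z.1 - f0 z.1) j * (p0 z.1 - p z.1) i) * ∫ u in (0:ℝ)..1,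
      (T (v • f z.1 + (1 - v) • f0 z.1, u • p z.1 + (1 - u) • p0 z.1)
        (0, EuclideanSpace.single i 1)) j := by
    intro v
    rw [intervalIntegral.integral_finsetSum]
    · refine Finset.sum_congr rfl fun j _ => ?_
      rw [intervalIntegral.integral_finsetSum]
      · refine Finset.sum_congr rfl fun i _ => ?_
        rw [intervalIntegral.integral_const_mul]
      · intro i _
        exact (continuous_const.mul (hC1 i j v)).intervalIntegrable _ _
    · intro j _
      exact (continuous_finsetSum _ fun i _ =>
        continuous_const.mul (hC1 i j v)).intervalIntegrable _ _
  simp_rw [e1]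
  rw [intervalIntegral.integral_finsetSum]
  · rw [PiLp.inner_apply]
    refine Finset.sum_congr rfl fun j _ => ?_
    rw [intervalIntegral.integral_finsetSum]
    · have ht : (tmulVec (gammaTilde ℓ p0 f0 f p z) (p0 z.1 - p z.1)) j =
          ∑ i, gammaTilde ℓ p0 f0 f p z i j * (p0 z.1 - p z.1) i := rfl
      simp only [RCLike.inner_apply, conj_trivial, ht, gammaTilde,
        crossDeriv_eq ℓ z.1 z.2 h, ← hT, intervalIntegral.integral_const_mul, Finset.mul_sum]
      refine Finset.sum_congr rfl fun i _ => ?_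
      ring
    · intro i _
      exact (continuous_const.mul (hC2 i j)).intervalIntegrable _ _
  · intro j _
    exact (continuous_finsetSum _ fun i _ =>
      continuous_const.mul (hC2 i j)).intervalIntegrable _ _

lemma young_aux {k : ℕ} (a D : Vec k) (σ : ℝ) (hσ : 0 < σ) :
    ⟪a, D⟫ - σ / 2 * ‖D‖ ^ 2 ≤ 1 / (2 * σ) * ‖a‖ ^ 2 := by
  have h := real_inner_le_norm a D
  have h2 : 1 / (2 * σ) * ‖a‖ ^ 2 - ‖a‖ * ‖D‖ + σ / 2 * ‖D‖ ^ 2 =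
      1 / (2 * σ) * (‖a‖ - σ * ‖D‖) ^ 2 := by
    field_simp
    ring
  have h3 : 0 ≤ 1 / (2 * σ) * (‖a‖ - σ * ‖D‖) ^ 2 := by positivity
  linarith

/-- **Empirical excess-risk bound for the plug-in ERM student (intermediate step
of the refined Vanilla KD theorem).** -/
theorem empirical_excess_risk_plugin_erm
    {𝒳 : Type*} {k n : ℕ} (hn : 0 < n)
    (z : Fin n → 𝒳 × Vec k)
    (ℓ : 𝒳 → Vec k → Vec k → Vec k → ℝ)
    (F : Set (𝒳 → Vec k)) (hF : Convex ℝ F)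
    (p0 phat fhat : 𝒳 → Vec k)
    (σ : ℝ) (hσ : 0 < σ)
    -- σ-strong convexity of ℓ in φ, for every z
    (hconv : ∀ x y pv φ φ', ℓ x y φ pv + ⟪gradPhi ℓ x y φ pv, φ' - φ⟫ +
      σ / 2 * ‖φ' - φ‖ ^ 2 ≤ ℓ x y φ' pv)
    -- ℓ is (continuously differentiable in φ and) twice continuously
    -- differentiable in (φ, π)
    (hsmooth : ∀ x y, ContDiff ℝ 2 (fun q : Vec k × Vec k => ℓ x y q.1 q.2))
    -- f̂ is the plug-in empirical risk minimizer over F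
    (hfhat : fhat ∈ F)
    (hmin : ∀ f ∈ F,
      (∑ i, ℓ (z i).1 (z i).2 (fhat (z i).1) (phat (z i).1)) ≤
        ∑ i, ℓ (z i).1 (z i).2 (f (z i).1) (phat (z i).1)) :
    ∀ f0 ∈ F,
      (1 / (n : ℝ)) * ∑ i, (ℓ (z i).1 (z i).2 (fhat (z i).1) (p0 (z i).1) -
          ℓ (z i).1 (z i).2 (f0 (z i).1) (p0 (z i).1)) ≤
        (1 / (2 * σ)) * ((1 / (n : ℝ)) * ∑ i,
          ‖tmulVec (gammaTilde ℓ p0 f0 fhat phat (z i))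
            (p0 (z i).1 - phat (z i).1)‖ ^ 2) := by
  intro f0 hf0
  have hopt : (∑ i, (ℓ (z i).1 (z i).2 (fhat (z i).1) (phat (z i).1) -
      ℓ (z i).1 (z i).2 (f0 (z i).1) (phat (z i).1))) ≤
      -(∑ i, σ / 2 * ‖fhat (z i).1 - f0 (z i).1‖ ^ 2) := by
    apply lim_aux
    intro t ht0 ht1
    have hm := hmin ((1 - t) • fhat + t • f0)
      (hF hfhat hf0 (by linarith) ht0.le (by ring))
    have hs : (∑ i, ℓ (z i).1 (z i).2 (((1 - t) • fhat + t • f0) (z i).1) (phat (z i).1)) ≤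
        ∑ i, ((1 - t) * ℓ (z i).1 (z i).2 (fhat (z i).1) (phat (z i).1) +
          t * ℓ (z i).1 (z i).2 (f0 (z i).1) (phat (z i).1) -
          σ / 2 * (t * (1 - t)) * ‖fhat (z i).1 - f0 (z i).1‖ ^ 2) := by
      refine Finset.sum_le_sum fun i _ => ?_
      exact sc_aux (fun φ => ℓ (z i).1 (z i).2 φ (phat (z i).1))
        (fun φ => gradPhi ℓ (z i).1 (z i).2 φ (phat (z i).1)) σ
        (fun φ φ' => hconv _ _ _ φ φ') (fhat (z i).1) (f0 (z i).1) t ht0.le ht1.le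
    have hms := hm.trans hs
    have key : t * ((∑ i, (ℓ (z i).1 (z i).2 (fhat (z i).1) (phat (z i).1) -
      ℓ (z i).1 (z i).2 (f0 (z i).1) (phat (z i).1))) +
      (1 - t) * ∑ i, σ / 2 * ‖fhat (z i).1 - f0 (z i).1‖ ^ 2) ≤ 0 := by
      rw [← sub_nonneg, ← Finset.sum_sub_distrib] at hms
      rw [← neg_nonneg]
      refine hms.trans_eq (Eq.symm ?_)
      rw [Finset.mul_sum, ← Finset.sum_add_distrib, Finset.mul_sum, ← Finset.sum_neg_distrib]
      refine Finset.sum_congr rfl fun i _ => ?_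
      ring
    have := nonpos_of_mul_nonpos_right key ht0
    linarith
  have hsum : (∑ i, (ℓ (z i).1 (z i).2 (fhat (z i).1) (p0 (z i).1) -
      ℓ (z i).1 (z i).2 (f0 (z i).1) (p0 (z i).1))) ≤
      1 / (2 * σ) * ∑ i, ‖tmulVec (gammaTilde ℓ p0 f0 fhat phat (z i))
            (p0 (z i).1 - phat (z i).1)‖ ^ 2 := by
    have hy := Finset.sum_le_sum (s := Finset.univ) fun (i : Fin n) _ =>
      young_aux (tmulVec (gammaTilde ℓ p0 f0 fhat phat (z i)) (p0 (z i).1 - phat (z i).1))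
        (fhat (z i).1 - f0 (z i).1) σ hσ
    simp only [fun i => gamma_inner ℓ p0 f0 fhat phat (z i) (hsmooth _ _)] at hy
    rw [← Finset.mul_sum, Finset.sum_sub_distrib, Finset.sum_sub_distrib] at hy
    linarith
  have hn' : (0:ℝ) ≤ 1 / (n : ℝ) := by positivity
  calc _ ≤ _ := mul_le_mul_of_nonneg_left hsum hn'
    _ = _ := by ring
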